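/- arXiv:0909.0743 — 3 statements merged into one kernel-verified Lean document; each statement's English description precedes it below -/
import Mathlib

section
/- Let p be a prime and f ∈ WKS^0_{p,2}. Then f has a unique zero ξ ∈ ℤ_p, and there exists a continuous function f* : ℤ_p → ℤ_p with f(s) = p·(s−ξ)·f*(s) and f*(s) − Δ¹f(0)/p ∈ pℤ_p for all s ∈ ℤ_p; in particular ‖f(s)‖_p = p^{−1}·‖s − ξ‖_p for all s ∈ ℤ_p. -/
open Finset

/-- The forward difference operator `Δ_h^n` with increment `h ≥ 1`:
`Δ_h^n f(s) = ∑_{ν=0}^n (n choose ν)·(−1)^(n−ν)·f(s+νh)`. -/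
noncomputable def deltaH (p : ℕ) [Fact p.Prime] (h : ℕ) (f : ℤ_[p] → ℤ_[p]) (n : ℕ)
    (s : ℤ_[p]) : ℤ_[p] :=
  ∑ ν ∈ Finset.range (n + 1),
    (n.choose ν : ℤ_[p]) * (-1) ^ (n - ν) * f (s + (ν : ℤ_[p]) * (h : ℤ_[p]))

/-- `f ∈ KS_{p,2}`: `f` is continuous and satisfies the Kummer type congruences
`Δ^n f(s) ∈ p^n ℤ_p` for all integers `n ≥ 0` and all `s ∈ ℤ_p`. -/
def KS2 (p : ℕ) [Fact p.Prime] (f : ℤ_[p] → ℤ_[p]) : Prop :=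
  Continuous f ∧ ∀ (n : ℕ) (s : ℤ_[p]), (p : ℤ_[p]) ^ n ∣ deltaH p 1 f n s

/-- `f ∈ WKS^0_{p,2}`: `f ∈ KS_{p,2}`, `f(0) ∈ pℤ_p`, `Δ¹f(0)/p` is a unit of `ℤ_p`, and
additionally `Δ²f(0)/4 ∈ 2ℤ_2` (i.e. `8 ∣ Δ²f(0)`) in case `p = 2`. -/
def WKS0 (p : ℕ) [Fact p.Prime] (f : ℤ_[p] → ℤ_[p]) : Prop :=
  KS2 p f ∧ (p : ℤ_[p]) ∣ f 0 ∧
    (∃ u : ℤ_[p], IsUnit u ∧ deltaH p 1 f 1 0 = (p : ℤ_[p]) * u) ∧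
    (p = 2 → (p : ℤ_[p]) ^ 3 ∣ deltaH p 1 f 2 0)

open Filter Topology

lemma deltaH_one_eq_fwdDiff_iter (p : ℕ) [Fact p.Prime] (f : ℤ_[p] → ℤ_[p]) (n : ℕ)
    (s : ℤ_[p]) : deltaH p 1 f n s = (fwdDiff 1)^[n] f s := by
  rw [fwdDiff_iter_eq_sum_shift, deltaH]
  refine Finset.sum_congr rfl fun k _ => ?_
  simp only [Nat.cast_one, mul_one, zsmul_eq_mul, nsmul_eq_mul]
  push_cast
  ring

namespace PadicInt

variable {p : ℕ} [hp : Fact p.Prime]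

lemma pow_dvd_iff_norm_le (n : ℕ) (x : ℤ_[p]) :
    (p : ℤ_[p]) ^ n ∣ x ↔ ‖x‖ ≤ (p : ℝ) ^ (-n : ℤ) := by
  rw [norm_le_pow_iff_mem_span_pow, Ideal.mem_span_singleton]

lemma isClosed_setOf_pow_dvd (n : ℕ) : IsClosed {x : ℤ_[p] | (p : ℤ_[p]) ^ n ∣ x} := by
  simp only [pow_dvd_iff_norm_le]
  exact isClosed_le continuous_norm continuous_const

/-- Divisibility by a power of `p` of the values of a continuous function can be tested on `ℕ`. -/
lemma pow_dvd_of_forall_natCast {F : ℤ_[p] → ℤ_[p]} (hF : Continuous F) (n : ℕ)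
    (h : ∀ m : ℕ, (p : ℤ_[p]) ^ n ∣ F m) (x : ℤ_[p]) : (p : ℤ_[p]) ^ n ∣ F x :=
  denseRange_natCast.induction_on x ((isClosed_setOf_pow_dvd n).preimage hF) h

lemma inv_natCast_le_norm {n : ℕ} (hn : n ≠ 0) : (n : ℝ)⁻¹ ≤ ‖(n : ℤ_[p])‖ := by
  have h0 : (n : ℤ_[p]) ≠ 0 := Nat.cast_ne_zero.mpr hn
  rw [norm_eq_zpow_neg_valuation h0, ← valuation_coe, coe_natCast, Padic.valuation_natCast,
    zpow_neg, zpow_natCast]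
  have h1 : 0 < p ^ padicValNat p n := pow_pos hp.out.pos _
  refine inv_anti₀ (by exact_mod_cast h1) ?_
  exact_mod_cast Nat.le_of_dvd (Nat.pos_of_ne_zero hn) pow_padicValNat_dvd

/-- If `p ^ n ∣ x`, then `x / n` is a `p`-adic integer of norm at most `n * p ^ (-n)`. -/
lemma exists_natCast_mul_eq_of_pow_dvd {n : ℕ} (hn : n ≠ 0) {x : ℤ_[p]}
    (hx : (p : ℤ_[p]) ^ n ∣ x) :
    ∃ c : ℤ_[p], (n : ℤ_[p]) * c = x ∧ ‖c‖ ≤ n * ((p : ℝ)⁻¹) ^ n := by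
  have h0 : (n : ℤ_[p]) ≠ 0 := Nat.cast_ne_zero.mpr hn
  have hv : (n : ℤ_[p]) ∣ x := by
    refine dvd_trans ?_ hx
    rw [unitCoeff_spec h0, Units.mul_left_dvd]
    refine pow_dvd_pow _ ?_
    have hval : (n : ℤ_[p]).valuation = padicValNat p n := by
      have h := valuation_coe (n : ℤ_[p])
      rw [coe_natCast, Padic.valuation_natCast] at h
      exact_mod_cast h.symm
    rw [hval]
    exact (padicValNat_le_nat_log (p := p) n).trans (Nat.log_le_self p n)
  obtain ⟨c, rfl⟩ := hv
  refine ⟨c, rfl, ?_⟩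
  have h1 := (pow_dvd_iff_norm_le _ _).mp hx
  rw [norm_mul, zpow_neg, zpow_natCast, ← inv_pow] at h1
  have h2 := inv_natCast_le_norm (p := p) hn
  have hn' : (0 : ℝ) < n := by exact_mod_cast Nat.pos_of_ne_zero hn
  calc ‖c‖ = n * ((n : ℝ)⁻¹ * ‖c‖) := by field_simp
    _ ≤ n * ((p : ℝ)⁻¹) ^ n := by
      gcongr
      exact (mul_le_mul_of_nonneg_right h2 (norm_nonneg c)).trans h1

end PadicInt

section WKS0

variable {p : ℕ} [hp : Fact p.Prime] {f : ℤ_[p] → ℤ_[p]}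

lemma continuous_fwdDiff_iter (hf : Continuous f) (n : ℕ) : Continuous ((fwdDiff 1)^[n] f) := by
  induction n with
  | zero => exact hf
  | succ n ih =>
    rw [Function.iterate_succ_apply']
    exact (ih.comp (continuous_id.add continuous_const)).sub ih

/-- A congruence for `Δ^(n+1) f` holding everywhere makes `Δ^n f` constant to that modulus. -/
lemma pow_dvd_fwdDiff_iter_sub (hf : Continuous f) {k n : ℕ}
    (h : ∀ s, (p : ℤ_[p]) ^ k ∣ (fwdDiff 1)^[n + 1] f s) (s : ℤ_[p]) :
    (p : ℤ_[p]) ^ k ∣ (fwdDiff 1)^[n] f s - (fwdDiff 1)^[n] f 0 := by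
  refine PadicInt.pow_dvd_of_forall_natCast
    (F := fun s => (fwdDiff 1)^[n] f s - (fwdDiff 1)^[n] f 0)
    ((continuous_fwdDiff_iter hf n).sub continuous_const) k (fun m => ?_) s
  induction m with
  | zero => simp
  | succ m ih =>
    have h1 := h m
    rw [Function.iterate_succ_apply', fwdDiff] at h1
    have := dvd_add h1 ih
    push_cast
    convert this using 1
    ring

/-- The difference quotient of `f` at an arbitrary base point `t` is a continuous function
congruent to `Δ f(0)` modulo `p ^ 2`. -/
lemma WKS0.exists_difference_quotient (hf : WKS0 p f) (t : ℤ_[p]) :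
    ∃ G : ℤ_[p] → ℤ_[p], Continuous G ∧ (∀ s, f s - f t = (s - t) * G s) ∧
      ∀ s, (p : ℤ_[p]) ^ 2 ∣ G s - deltaH p 1 f 1 0 := by
  obtain ⟨⟨hcont, hK⟩, -, -, h8⟩ := hf
  simp only [deltaH_one_eq_fwdDiff_iter] at hK h8 ⊢
  choose c hc hcn using fun k : ℕ =>
    PadicInt.exists_natCast_mul_eq_of_pow_dvd (Nat.succ_ne_zero k) (hK (k + 1) t)
  have hp1 : (1 : ℝ) < p := by exact_mod_cast hp.out.one_lt
  have hp2 : 2 ≤ p := hp.out.two_le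
  have hlim : Tendsto c atTop (𝓝 0) := by
    refine squeeze_zero_norm hcn ?_
    exact (tendsto_add_atTop_iff_nat 1).mpr
      (tendsto_self_mul_const_pow_of_lt_one (by positivity) (inv_lt_one_of_one_lt₀ hp1))
  have hnat (m : ℕ) : PadicInt.mahlerSeries c (m : ℤ_[p]) =
      ∑ i ∈ Finset.range (m + 1), (m.choose i : ℤ_[p]) * c i := by
    simpa only [nsmul_eq_mul] using PadicInt.mahlerSeries_apply_nat hlim (le_refl m)
  have hc0 : (p : ℤ_[p]) ^ 2 ∣ c 0 - (fwdDiff 1)^[1] f 0 := by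
    have h := pow_dvd_fwdDiff_iter_sub hcont (n := 1) (hK 2) t
    rw [← hc 0] at h
    simpa using h
  have hck (k : ℕ) : (p : ℤ_[p]) ^ 2 ∣ c (k + 1) := by
    by_cases hk : p = 2 ∧ k = 0
    · obtain ⟨h2, rfl⟩ := hk
      have h3 : (p : ℤ_[p]) ^ 3 ∣ (fwdDiff 1)^[2] f t := by
        have h := dvd_add (pow_dvd_fwdDiff_iter_sub hcont (n := 2) (hK 3) t) (h8 h2)
        simpa using h
      rw [← hc 1, pow_succ'] at h3
      have hcast : ((1 + 1 : ℕ) : ℤ_[p]) = p := congrArg Nat.cast h2.symm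
      simp only [Nat.succ_eq_add_one] at h3
      rw [hcast] at h3
      exact (mul_dvd_mul_iff_left (Nat.cast_ne_zero.mpr hp.out.ne_zero)).mp h3
    · have hlt : k + 2 < p ^ (k + 1) := by
        rcases Nat.eq_zero_or_pos k with rfl | hk0
        · have : p ≠ 2 := fun h => hk ⟨h, rfl⟩
          simp only [zero_add, pow_one]
          omega
        · refine lt_of_lt_of_le ?_ (Nat.pow_le_pow_left hp2 (k + 1))
          obtain ⟨j, rfl⟩ : ∃ j, k = j + 1 := ⟨k - 1, by omega⟩
          have := Nat.lt_two_pow_self (n := j)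
          rw [pow_succ, pow_succ]
          omega
      rw [PadicInt.pow_dvd_iff_norm_le, PadicInt.norm_le_pow_iff_norm_lt_pow_add_one]
      refine (hcn (k + 1)).trans_lt ?_
      have hlt' : ((k + 1).succ : ℝ) < (p : ℝ) ^ (k + 1) := by exact_mod_cast hlt
      calc ((k + 1).succ : ℝ) * (p : ℝ)⁻¹ ^ (k + 1).succ
          < (p : ℝ) ^ (k + 1) * (p : ℝ)⁻¹ ^ (k + 1).succ := by gcongr
        _ = (p : ℝ)⁻¹ := by
          rw [Nat.succ_eq_add_one, pow_succ (p : ℝ)⁻¹, ← mul_assoc, ← mul_pow,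
            mul_inv_cancel₀ (by positivity), one_pow, one_mul]
        _ = _ := by norm_num [zpow_neg_one]
  have hquot (y : ℤ_[p]) : f (t + y + 1) - f t = (y + 1) * PadicInt.mahlerSeries c y := by
    refine congr_fun (PadicInt.denseRange_natCast.equalizer
      (g := fun y => f (t + y + 1) - f t) (h := fun y => (y + 1) * PadicInt.mahlerSeries c y)
      (by fun_prop) (by fun_prop) (funext fun m => ?_)) y
    have h := shift_eq_sum_fwdDiff_iter (1 : ℤ_[p]) f (m + 1) t
    rw [Finset.sum_range_succ'] at h
    simp only [nsmul_eq_mul, mul_one, Nat.choose_zero_right, Nat.cast_one, one_mul,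
      Function.iterate_zero, id_eq] at h
    simp only [Function.comp_apply]
    rw [hnat, Finset.mul_sum, add_assoc, ← Nat.cast_succ, Nat.succ_eq_add_one, h,
      add_sub_cancel_right]
    refine Finset.sum_congr rfl fun i _ => ?_
    rw [← hc i, ← mul_assoc, ← mul_assoc]
    congr 1
    exact_mod_cast (Nat.add_one_mul_choose_eq m i).symm
  refine ⟨fun s => PadicInt.mahlerSeries c (s - t - 1), by fun_prop, fun s => ?_, fun s => ?_⟩
  · have h := hquot (s - t - 1)
    rw [show t + (s - t - 1) + 1 = s by ring, sub_add_cancel] at h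
    exact h
  · refine PadicInt.pow_dvd_of_forall_natCast
      (F := fun y => PadicInt.mahlerSeries c y - (fwdDiff 1)^[1] f 0)
      (by fun_prop) 2 (fun m => ?_) (s - t - 1)
    rw [hnat, Finset.sum_range_succ', add_sub_assoc]
    refine dvd_add (Finset.dvd_sum fun i _ => (hck i).mul_left _) ?_
    simpa using hc0

lemma WKS0.exists_zero (hf : WKS0 p f) : ∃ ξ, f ξ = 0 := by
  have hcont : Continuous f := hf.1.1
  obtain ⟨ξ, -, hξ⟩ := isCompact_univ.exists_isMinOn (f := fun s => ‖f s‖) Set.univ_nonempty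
    hcont.norm.continuousOn
  refine ⟨ξ, by_contra fun h0 => ?_⟩
  obtain ⟨-, hf0, ⟨u, hu, hd⟩, -⟩ := id hf
  obtain ⟨v, hv⟩ := hu.exists_right_inv
  have hdvd : (p : ℤ_[p]) ∣ f ξ := by
    obtain ⟨G, -, hG, hGd⟩ := hf.exists_difference_quotient 0
    have h1 : (p : ℤ_[p]) ∣ G ξ := by
      have h2 := (dvd_pow_self (p : ℤ_[p]) two_ne_zero).trans (hGd ξ)
      rw [hd] at h2
      exact (dvd_sub_left (dvd_mul_right _ _)).mp h2
    exact (dvd_sub_left hf0).mp (hG ξ ▸ h1.mul_left _)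
  obtain ⟨a, ha⟩ := hdvd
  obtain ⟨G, -, hG, hGd⟩ := hf.exists_difference_quotient ξ
  obtain ⟨w, hw⟩ := hGd (ξ - v * a)
  have hval : f (ξ - v * a) = p * (-(v * w)) * f ξ := by
    have h := hG (ξ - v * a)
    rw [eq_add_of_sub_eq hw, hd] at h
    linear_combination h + ((p : ℤ_[p]) * v * w + 1) * ha - (p : ℤ_[p]) * a * hv
  have hle : ‖f ξ‖ ≤ ‖f (ξ - v * a)‖ := hξ (Set.mem_univ _)
  have hlt : ‖(p : ℤ_[p]) * (-(v * w))‖ < 1 :=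
    (PadicInt.norm_lt_one_iff_dvd _).mpr (dvd_mul_right _ _)
  rw [hval, norm_mul] at hle
  exact absurd hle (not_le.mpr (mul_lt_of_lt_one_left (norm_pos_iff.mpr h0) hlt))

end WKS0

theorem stmt10 (p : ℕ) [Fact p.Prime] (f : ℤ_[p] → ℤ_[p]) (hf : WKS0 p f) :
    ∃ ξ : ℤ_[p], f ξ = 0 ∧ (∀ ξ' : ℤ_[p], f ξ' = 0 → ξ' = ξ) ∧
      (∀ s : ℤ_[p], ‖f s‖ = (p : ℝ)⁻¹ * ‖s - ξ‖) ∧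
      ∃ g : ℤ_[p] → ℤ_[p], Continuous g ∧
        ∀ s : ℤ_[p], f s = (p : ℤ_[p]) * (s - ξ) * g s ∧
          (p : ℤ_[p]) ^ 2 ∣ (p : ℤ_[p]) * g s - deltaH p 1 f 1 0 := by
  have hp0 : (p : ℤ_[p]) ≠ 0 := Nat.cast_ne_zero.mpr (Fact.out : p.Prime).ne_zero
  obtain ⟨ξ, hξ⟩ := hf.exists_zero
  obtain ⟨G, hGc, hG, hGd⟩ := hf.exists_difference_quotient ξ
  obtain ⟨-, -, ⟨u, hu, hd⟩, -⟩ := id hf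
  choose w hw using hGd
  have hGg (s : ℤ_[p]) : G s = p * (u + p * w s) := by
    linear_combination hw s + hd
  have hfac (s : ℤ_[p]) : f s = (p : ℤ_[p]) * (s - ξ) * (u + p * w s) := by
    have h := hG s
    rw [hξ, hGg] at h
    linear_combination h
  have hnorm (s : ℤ_[p]) : ‖f s‖ = (p : ℝ)⁻¹ * ‖s - ξ‖ := by
    have hu1 : ‖u‖ = 1 := PadicInt.isUnit_iff.mp hu
    have hlt : ‖(p : ℤ_[p]) * w s‖ < 1 :=
      (PadicInt.norm_lt_one_iff_dvd _).mpr (dvd_mul_right _ _)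
    have h1 : ‖u + p * w s‖ = 1 := by
      rw [PadicInt.norm_add_eq_max_of_ne (by rw [hu1]; exact hlt.ne'), hu1, max_eq_left hlt.le]
    rw [hfac, norm_mul, norm_mul, h1, mul_one, PadicInt.norm_p]
  have hemb : IsClosedEmbedding (fun x : ℤ_[p] => (p : ℤ_[p]) * x) :=
    (continuous_const_mul _).isClosedEmbedding (mul_right_injective₀ hp0)
  refine ⟨ξ, hξ, fun s hs => ?_, hnorm, fun s => u + p * w s, ?_, fun s => ⟨hfac s, w s, ?_⟩⟩
  · have h1 := hnorm s
    rw [hs, norm_zero, eq_comm, mul_eq_zero] at h1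
    rcases h1 with h1 | h1
    · exact absurd h1 (by simpa using (Fact.out : p.Prime).ne_zero)
    · exact sub_eq_zero.mp (norm_eq_zero.mp h1)
  · rw [hemb.isInducing.continuous_iff]
    convert hGc using 1
    exact funext fun s => (hGg s).symm
  · rw [← hGg, hw]
end

section
/- Let p > 3 be a prime and f ∈ KS_{p,2} such that Δ¹f(0) ∈ p²ℤ_p, Δ²f(0)/p² is a unit of ℤ_p, and f has at least one zero in ℤ_p. Then there exist ξ₁, ξ₂ ∈ ℤ_p with f(ξ₁) = f(ξ₂) = 0 and a continuous function f* : ℤ_p → ℤ_p with f*(s) − (Δ²f(0)/p²)/2 ∈ pℤ_p for all s, such that f(s) = p²·(s−ξ₁)·(s−ξ₂)·f*(s); in particular ‖f(s)‖_p = p^{−2}·‖s−ξ₁‖_p·‖s−ξ₂‖_p for all s ∈ ℤ_p. -/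
open Finset

/-- `h` is a sum `∑ p ^ (n / 2) * P n` with polynomials `P n` over `ℤ_[p]`. -/
def IsPadicPolySum (p : ℕ) [Fact p.Prime] (h : ℤ_[p] → ℤ_[p]) : Prop :=
  ∃ P : ℕ → Polynomial ℤ_[p], ∀ s, HasSum (fun n ↦ (p : ℤ_[p]) ^ (n / 2) * (P n).eval s) (h s)

section

open Polynomial Filter Topology

variable {p : ℕ} [Fact p.Prime]

lemma PadicInt.summable_pow_half_mul (a : ℕ → ℤ_[p]) :
    Summable fun n ↦ (p : ℤ_[p]) ^ (n / 2) * a n := by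
  refine NonarchimedeanAddGroup.summable_of_tendsto_cofinite_zero ?_
  rw [Nat.cofinite_eq_atTop]
  have hp : ‖(p : ℤ_[p])‖ < 1 := by
    rw [PadicInt.norm_p]
    exact inv_lt_one_of_one_lt₀ (mod_cast (Fact.out : p.Prime).one_lt)
  have h := (tendsto_pow_atTop_nhds_zero_of_norm_lt_one hp).comp
    (Nat.tendsto_div_const_atTop two_ne_zero)
  refine squeeze_zero_norm (fun n ↦ ?_) (tendsto_zero_iff_norm_tendsto_zero.mp h)
  rw [norm_mul]
  exact mul_le_of_le_one_right (norm_nonneg _) (PadicInt.norm_le_one _)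

namespace IsPadicPolySum

variable {h : ℤ_[p] → ℤ_[p]}

lemma exists_sub_eq_mul (hh : IsPadicPolySum p h) (t : ℤ_[p]) :
    ∃ k, IsPadicPolySum p k ∧ ∀ s, h s - h t = (s - t) * k s := by
  obtain ⟨P, hP⟩ := hh
  let Q : ℕ → Polynomial ℤ_[p] := fun n ↦ P n /ₘ (X - C t)
  have hQ (s : ℤ_[p]) := (PadicInt.summable_pow_half_mul fun n ↦ (Q n).eval s).hasSum
  refine ⟨_, ⟨Q, hQ⟩, fun s ↦ ((hP s).sub (hP t)).unique ?_⟩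
  convert! (hQ s).mul_left (s - t) using 2 with n
  have hn := congrArg (eval s) (modByMonic_add_div (P n) (X - C t))
  rw [modByMonic_X_sub_C_eq_C_eval] at hn
  simp only [eval_add, eval_mul, eval_sub, eval_X, eval_C] at hn
  linear_combination -(p : ℤ_[p]) ^ (n / 2) * hn

lemma dist_le (hh : IsPadicPolySum p h) (s t : ℤ_[p]) : dist (h s) (h t) ≤ dist s t := by
  obtain ⟨k, -, hk⟩ := hh.exists_sub_eq_mul t
  rw [dist_eq_norm, dist_eq_norm, hk, norm_mul]
  exact mul_le_of_le_one_right (norm_nonneg _) (PadicInt.norm_le_one _)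

protected lemma continuous (hh : IsPadicPolySum p h) : Continuous h :=
  (LipschitzWith.of_dist_le_mul (K := 1) (by simpa using hh.dist_le)).continuous

lemma exists_isFixedPt (hh : IsPadicPolySum p h) (a c : ℤ_[p]) :
    ∃ x, a * (c + p * h x) = x := by
  have hp : 1 < (p : ℝ) := mod_cast (Fact.out : p.Prime).one_lt
  have hT : ContractingWith (p : NNReal)⁻¹ fun s ↦ a * (c + p * h s) := by
    refine ⟨inv_lt_one_of_one_lt₀ (mod_cast hp), LipschitzWith.of_dist_le_mul fun s t ↦ ?_⟩
    have : a * (c + p * h s) - a * (c + p * h t) = a * (p * (h s - h t)) := by ring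
    rw [dist_eq_norm, this, norm_mul, norm_mul, PadicInt.norm_p, ← dist_eq_norm]
    refine (mul_le_of_le_one_left (by positivity) (PadicInt.norm_le_one _)).trans ?_
    push_cast
    gcongr
    exact hh.dist_le s t
  exact ⟨_, hT.fixedPoint_isFixedPt⟩

end IsPadicPolySum

lemma deltaH_one_zero (f : ℤ_[p] → ℤ_[p]) (n : ℕ) : deltaH p 1 f n 0 = (fwdDiff 1)^[n] f 0 := by
  rw [fwdDiff_iter_eq_sum_shift, deltaH]
  refine Finset.sum_congr rfl fun k _ ↦ ?_
  simp [mul_comm]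

lemma PadicInt.factorial_dvd_pow (hp : 3 < p) (n : ℕ) :
    ((n + 3).factorial : ℤ_[p]) ∣ (p : ℤ_[p]) ^ (n - n / 2) := by
  have hpp : p.Prime := Fact.out
  obtain ⟨e, m, hm, hem⟩ := Nat.exists_eq_pow_mul_and_not_dvd
    (Nat.factorial_ne_zero (n + 3)) p hpp.ne_one
  have he : e ≤ padicValNat p (n + 3).factorial :=
    (padicValNat_dvd_iff_le (Nat.factorial_ne_zero _)).mp (hem ▸ dvd_mul_right _ _)
  have hlt := sub_one_mul_padicValNat_factorial_lt_of_ne_zero (p := p) (n := n + 3) (by omega)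
  have h5 : 4 ≤ p - 1 := by
    have : p ≠ 4 := by rintro rfl; exact absurd hpp (by norm_num)
    omega
  have := Nat.mul_le_mul h5 he
  have hu : IsUnit (m : ℤ_[p]) := by
    rw [PadicInt.isUnit_iff, PadicInt.norm_natCast_eq_one_iff]
    exact (Nat.Prime.coprime_iff_not_dvd hpp).mpr hm
  rw [hem]
  push_cast
  exact hu.mul_right_dvd.mpr (pow_dvd_pow _ (by omega))

lemma KS2.exists_isPadicPolySum (hp : 3 < p) {f : ℤ_[p] → ℤ_[p]} (hf : KS2 p f) :
    ∃ h, IsPadicPolySum p h ∧ ∀ s, f s = f 0 + deltaH p 1 f 1 0 * s +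
      deltaH p 1 f 2 0 * Ring.choose s 2 + (p : ℤ_[p]) ^ 3 * h s := by
  obtain ⟨hc, hd⟩ := hf
  choose d hd using fun n ↦ hd n 0
  choose q hq using fun n ↦ PadicInt.factorial_dvd_pow (p := p) hp n
  let P (n : ℕ) : Polynomial ℤ_[p] :=
    C (d (n + 3) * q n) * (descPochhammer ℤ (n + 3)).map (Int.castRingHom ℤ_[p])
  have hP (s : ℤ_[p]) := (PadicInt.summable_pow_half_mul fun n ↦ (P n).eval s).hasSum
  refine ⟨_, ⟨P, hP⟩, fun s ↦ ?_⟩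
  have hs : HasSum (fun n ↦ deltaH p 1 f n 0 * Ring.choose s n) (f s) := by
    have := (PadicInt.hasSum_mahler (⟨f, hc⟩ : C(ℤ_[p], ℤ_[p]))).map
      (ContinuousMap.evalCLM ℤ_[p] s) (ContinuousMap.evalCLM ℤ_[p] s).continuous
    convert! this using 2 with n
    simp [deltaH_one_zero, PadicInt.mahlerTerm_apply, mahler_apply, mul_comm]
  have hs3 := (hasSum_nat_add_iff' 3).mpr hs
  have heq := hs3.unique (f := fun n ↦ deltaH p 1 f (n + 3) 0 * Ring.choose s (n + 3))
    (a₂ := (p : ℤ_[p]) ^ 3 * _) (by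
    convert! (hP s).mul_left ((p : ℤ_[p]) ^ 3) using 2 with n
    have hpow : (p : ℤ_[p]) ^ (n + 3) = p ^ 3 * p ^ (n / 2) * p ^ (n - n / 2) := by
      rw [← pow_add, ← pow_add]
      congr 1
      omega
    have hev : ((descPochhammer ℤ (n + 3)).map (Int.castRingHom ℤ_[p])).eval s =
        (n + 3).factorial * Ring.choose s (n + 3) := by
      rw [← nsmul_eq_mul, ← Ring.descPochhammer_eq_factorial_smul_choose, eval_map,
        ← eval₂_smulOneHom_eq_smeval]
      congr 1
      exact RingHom.ext_int _ _
    simp only [P, eval_mul, eval_C]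
    rw [hd, hpow, hq, hev]
    ring)
  rw [← heq]
  simp [Finset.sum_range_succ, deltaH]

end

theorem stmt14 (p : ℕ) [Fact p.Prime] (hp3 : 3 < p) (f : ℤ_[p] → ℤ_[p]) (hf : KS2 p f)
    (h1 : (p : ℤ_[p]) ^ 2 ∣ deltaH p 1 f 1 0)
    (u : ℤ_[p]) (hu : IsUnit u) (h2 : deltaH p 1 f 2 0 = (p : ℤ_[p]) ^ 2 * u)
    (hzero : ∃ ξ : ℤ_[p], f ξ = 0) :
    ∃ ξ₁ ξ₂ : ℤ_[p], f ξ₁ = 0 ∧ f ξ₂ = 0 ∧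
      ∃ g : ℤ_[p] → ℤ_[p], Continuous g ∧
        (∀ s : ℤ_[p], f s = (p : ℤ_[p]) ^ 2 * (s - ξ₁) * (s - ξ₂) * g s) ∧
        (∀ s : ℤ_[p], (p : ℤ_[p]) ∣ 2 * g s - u) ∧
        ∀ s : ℤ_[p], ‖f s‖ = (p : ℝ) ^ (-2 : ℤ) * ‖s - ξ₁‖ * ‖s - ξ₂‖ := by
  obtain ⟨h, hh, hfh⟩ := hf.exists_isPadicPolySum hp3
  obtain ⟨ξ, hξ⟩ := hzero
  obtain ⟨b, hb⟩ := h1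
  obtain ⟨k, hk, hhk⟩ := hh.exists_sub_eq_mul ξ
  obtain ⟨w, hw⟩ : ∃ w : ℤ_[p], 2 * w = 1 := by
    have : IsUnit ((2 : ℕ) : ℤ_[p]) := by
      rw [PadicInt.isUnit_iff, PadicInt.norm_natCast_eq_one_iff, Nat.coprime_comm]
      exact (Nat.coprime_primes Nat.prime_two Fact.out).mpr (by omega)
    exact this.exists_right_inv
  obtain ⟨v, hv⟩ := hu.exists_right_inv
  have hchoose (s : ℤ_[p]) : 2 * Ring.choose s 2 = s * (s - 1) := by
    have := Ring.descPochhammer_eq_factorial_smul_choose s 2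
    simp [descPochhammer_succ_right, Polynomial.smeval_mul,
      Polynomial.smeval_sub] at this
    linear_combination -this
  obtain ⟨η, hη⟩ := hk.exists_isFixedPt (-2 * v) (b + w * u * (ξ - 1))
  obtain ⟨l, hl, hkl⟩ := hk.exists_sub_eq_mul η
  have hfac (s : ℤ_[p]) : f s = (p : ℤ_[p]) ^ 2 * (s - ξ) * (s - η) * (w * u + p * l s) := by
    have e1 := hfh s
    have e2 := hfh ξ
    rw [hb, h2] at e1 e2
    have c1 : Ring.choose s 2 = w * (s * (s - 1)) := by
      linear_combination w * hchoose s - Ring.choose s 2 * hw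
    have c2 : Ring.choose ξ 2 = w * (ξ * (ξ - 1)) := by
      linear_combination w * hchoose ξ - Ring.choose ξ 2 * hw
    rw [c1] at e1
    rw [c2] at e2
    have e3 : b + w * u * (η + ξ - 1) + p * k η = 0 := by
      linear_combination - w * u * hη + (2 * w * (-(b + w * u * (ξ - 1) + p * k η))) * hv +
        (-(b + w * u * (ξ - 1) + p * k η)) * hw
    linear_combination e1 - e2 + hξ + (p : ℤ_[p]) ^ 3 * hhk s +
      (p : ℤ_[p]) ^ 3 * (s - ξ) * hkl s + (p : ℤ_[p]) ^ 2 * (s - ξ) * e3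
  have hdvd (s : ℤ_[p]) : (p : ℤ_[p]) ∣ 2 * (w * u + p * l s) - u :=
    ⟨2 * l s, by linear_combination u * hw⟩
  refine ⟨ξ, η, hξ, by rw [hfac]; ring, fun s ↦ w * u + p * l s,
    continuous_const.add (continuous_const.mul hl.continuous), hfac, hdvd, fun s ↦ ?_⟩
  have hnorm : ‖w * u + p * l s‖ = 1 := by
    rw [← PadicInt.isUnit_iff]
    by_contra hg
    rw [PadicInt.not_isUnit_iff, PadicInt.norm_lt_one_iff_dvd] at hg
    exact PadicInt.prime_p.not_isUnit
      (isUnit_of_dvd_unit ((dvd_sub_right (hg.mul_left 2)).mp (hdvd s)) hu)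
  rw [hfac, norm_mul, norm_mul, norm_mul, hnorm, mul_one, PadicInt.norm_p_pow]
  rfl
end

section
/- (Strong Kummer congruences for Bernoulli numbers.) Let p > 3 be a prime and l an even integer with 0 < l < p−1. Put ε_l = 1−p if l = 2 and ε_l = 1 otherwise. Then the following are equivalent: (i) v_p( B_{l+p−1}/(l+p−1) − ε_l·B_l/l ) ≤ 1; (ii) for all even positive integers n, m with n ≡ l (mod p−1) and m ≡ l (mod p−1), and every integer r ≥ 1: p^{r−1}·(p−1) divides n−m if and only if v_p( (1−p^{n−1})·B_n/n − (1−p^{m−1})·B_m/m ) ≥ r (with the conventions v_p(0) = +∞ and that 0 is divisible by every integer, covering the case n = m). -/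
open Finset Filter Topology

section PadicCongruences

lemma add_two_lt_pow_succ {p : ℕ} (hp : 3 ≤ p) (k : ℕ) : k + 2 < p ^ (k + 1) := by
  induction k with
  | zero => simpa using (show 2 < p by omega)
  | succ k ih => rw [pow_succ]; nlinarith

variable {p : ℕ} [Fact p.Prime]

lemma isUnit_natCast_of_not_dvd {k : ℕ} (hk : ¬p ∣ k) : IsUnit (k : ℤ_[p]) := by
  by_contra h
  rw [PadicInt.not_isUnit_iff] at h
  have := (PadicInt.norm_int_lt_one_iff_dvd (p := p) (k : ℤ)).1 (by simpa using h)
  exact hk (Int.natCast_dvd_natCast.1 this)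

lemma add_two_dvd_p_pow (hp : 3 ≤ p) (k : ℕ) : ((k + 2 : ℕ) : ℤ_[p]) ∣ (p : ℤ_[p]) ^ k := by
  obtain ⟨a, k', hk', hk⟩ := Nat.exists_eq_pow_mul_and_not_dvd (show k + 2 ≠ 0 by omega) p
    (by omega)
  have hk0 : 0 < k' := Nat.pos_of_ne_zero fun h => hk' (h ▸ dvd_zero p)
  have ha : a ≤ k := by
    have h1 : p ^ a < p ^ (k + 1) :=
      lt_of_le_of_lt (hk ▸ Nat.le_mul_of_pos_right _ hk0) (add_two_lt_pow_succ hp k)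
    have := (Nat.pow_lt_pow_iff_right (show 1 < p by omega)).1 h1
    omega
  have hu : IsUnit (k' : ℤ_[p]) := isUnit_natCast_of_not_dvd hk'
  rw [hk]
  push_cast
  exact hu.mul_right_dvd.2 (pow_dvd_pow _ ha)

lemma p_sq_mul_dvd_one_add_pow_sub (hp : 3 ≤ p) (z : ℤ_[p]) (d : ℕ) :
    (p : ℤ_[p]) ^ 2 * d ∣ (1 + p * z) ^ d - 1 - d * (p * z) := by
  rcases d with _ | e
  · simp
  rw [add_comm 1, add_pow, sum_range_succ', sum_range_succ']
  have h : (p : ℤ_[p]) ^ 2 * ((e + 1 : ℕ) : ℤ_[p]) ∣ ∑ m ∈ range e,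
      (p * z) ^ (m + 1 + 1) * 1 ^ (e + 1 - (m + 1 + 1)) * ((e + 1).choose (m + 1 + 1) : ℤ_[p]) := by
    refine dvd_sum fun m _ => ?_
    obtain ⟨w, hw⟩ := add_two_dvd_p_pow hp m
    have hc : ((e + 1 : ℕ) : ℤ_[p]) * (e.choose (m + 1) : ℤ_[p])
        = ((e + 1).choose (m + 1 + 1) : ℤ_[p]) * ((m + 2 : ℕ) : ℤ_[p]) := by
      exact_mod_cast Nat.add_one_mul_choose_eq e (m + 1)
    refine ⟨w * z ^ (m + 2) * e.choose (m + 1), ?_⟩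
    rw [one_pow, mul_pow, show m + 1 + 1 = m + 2 from rfl, pow_add (p : ℤ_[p]), hw]
    linear_combination (-(p : ℤ_[p]) ^ 2 * w * z ^ (m + 2)) * hc
  convert h using 1
  simp
  ring

lemma isClosed_setOf_dvd (x : ℤ_[p]) : IsClosed {y : ℤ_[p] | x ∣ y} := by
  have : {y : ℤ_[p] | x ∣ y} = Set.range (x * ·) := by
    ext y
    exact ⟨fun ⟨z, hz⟩ => ⟨z, hz.symm⟩, fun ⟨z, hz⟩ => ⟨z, hz.symm⟩⟩
  rw [this]
  exact (isCompact_range (by fun_prop)).isClosed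

/-- Sequences of `p`-adic integers which agree with a linear function with slope divisible by `p`,
up to a relative error of `p ^ 2`. -/
def IsLinearModSq (h : ℕ → ℤ_[p]) : Prop :=
  (p : ℤ_[p]) ∣ h 1 - h 0 ∧
    ∀ s t : ℕ, (p : ℤ_[p]) ^ 2 * (s - t) ∣ h s - h t - (s - t) * (h 1 - h 0)

namespace IsLinearModSq

lemma p_mul_dvd {h : ℕ → ℤ_[p]} (hh : IsLinearModSq h) (s t : ℕ) :
    (p : ℤ_[p]) * (s - t) ∣ h s - h t := by
  obtain ⟨a, ha⟩ := hh.1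
  obtain ⟨b, hb⟩ := hh.2 s t
  exact ⟨a + p * b, by rw [ha] at hb; linear_combination hb⟩

lemma const_mul {h : ℕ → ℤ_[p]} (hh : IsLinearModSq h) (a : ℤ_[p]) :
    IsLinearModSq fun s => a * h s := by
  refine ⟨?_, fun s t => ?_⟩
  · simpa only [← mul_sub] using hh.1.mul_left a
  · convert (hh.2 s t).mul_left a using 1
    ring

lemma sub_const {h : ℕ → ℤ_[p]} (hh : IsLinearModSq h) (a : ℤ_[p]) :
    IsLinearModSq fun s => h s - a := by
  simpa [IsLinearModSq] using hh

lemma sum {ι : Type*} (S : Finset ι) {h : ι → ℕ → ℤ_[p]} (hh : ∀ i ∈ S, IsLinearModSq (h i)) :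
    IsLinearModSq fun s => ∑ i ∈ S, h i s := by
  refine ⟨?_, fun s t => ?_⟩
  · simpa only [← sum_sub_distrib] using dvd_sum fun i hi => (hh i hi).1
  · simpa only [← sum_sub_distrib, mul_sum] using dvd_sum fun i hi => (hh i hi).2 s t

lemma of_tendsto {T : ℕ → ℕ → ℤ_[p]} {h : ℕ → ℤ_[p]} (hT : ∀ N, IsLinearModSq (T N))
    (hh : ∀ s, Tendsto (fun N => T N s) atTop (𝓝 (h s))) : IsLinearModSq h := by
  refine ⟨?_, fun s t => ?_⟩
  · exact (isClosed_setOf_dvd _).mem_of_tendsto ((hh 1).sub (hh 0)) (.of_forall fun N => (hT N).1)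
  · exact (isClosed_setOf_dvd _).mem_of_tendsto
      (((hh s).sub (hh t)).sub (((hh 1).sub (hh 0)).const_mul _)) (.of_forall fun N => (hT N).2 s t)

lemma pow (hp : 3 ≤ p) {y : ℤ_[p]} (hy : (p : ℤ_[p]) ∣ y - 1) :
    IsLinearModSq fun s => y ^ s := by
  refine ⟨by simpa using hy, ?_⟩
  have key : ∀ t d : ℕ, (p : ℤ_[p]) ^ 2 * d ∣ y ^ (t + d) - y ^ t - d * (y - 1) := by
    intro t d
    obtain ⟨a, ha⟩ := hy.trans (sub_one_dvd_pow_sub_one y t)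
    obtain ⟨z, hz⟩ := hy
    obtain ⟨w, hw⟩ := p_sq_mul_dvd_one_add_pow_sub hp z d
    rw [← hz, add_sub_cancel] at hw
    refine ⟨a * (z + p * w) + w, ?_⟩
    rw [hz] at hw ⊢
    linear_combination (y ^ d - 1) * ha + hw + p * a * hw
  intro s t
  rcases le_total t s with h | h
  · obtain ⟨d, rfl⟩ := Nat.exists_eq_add_of_le h
    simpa using key t d
  · obtain ⟨d, rfl⟩ := Nat.exists_eq_add_of_le h
    have := key s d
    rw [← dvd_neg, ← neg_dvd] at this
    convert this using 1
    · push_cast; ring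
    · push_cast; ring

lemma isUnit {u : ℕ → ℤ_[p]} (hu : IsLinearModSq u) (hu0 : IsUnit (u 0)) (s : ℕ) :
    IsUnit (u s) := by
  by_contra hs
  rw [PadicInt.not_isUnit_iff, PadicInt.norm_lt_one_iff_dvd] at hs
  have := (dvd_sub_right hs).1 ((dvd_mul_right _ _).trans (hu.p_mul_dvd s 0))
  exact PadicInt.prime_p.not_isUnit (isUnit_of_dvd_unit this hu0)

lemma of_mul {u f : ℕ → ℤ_[p]} (hu : IsLinearModSq u) (hu0 : IsUnit (u 0))
    (huf : IsLinearModSq fun s => u s * f s) : IsLinearModSq f := by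
  have hp_dvd : ∀ s t, (p : ℤ_[p]) ∣ u s - u t := fun s t =>
    (dvd_mul_right _ _).trans (hu.p_mul_dvd s t)
  have hunit : ∀ s, IsUnit (u s) := hu.isUnit hu0
  have h1 : ∀ s t : ℕ, (p : ℤ_[p]) * (s - t) ∣ f s - f t := by
    intro s t
    rw [← (hunit s).dvd_mul_left]
    have := dvd_sub (huf.p_mul_dvd s t) ((hu.p_mul_dvd s t).mul_left (f t))
    convert this using 1
    ring
  have hf_dvd : ∀ s t, (p : ℤ_[p]) ∣ f s - f t := fun s t => (dvd_mul_right _ _).trans (h1 s t)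
  refine ⟨hf_dvd 1 0, fun s t => ?_⟩
  rw [← (hunit s).dvd_mul_left]
  obtain ⟨a, ha⟩ := huf.2 s t
  obtain ⟨b, hb⟩ := hu.2 s t
  obtain ⟨c, hc⟩ := hu.1
  obtain ⟨d, hd⟩ := hf_dvd 0 t
  obtain ⟨e, he⟩ := hf_dvd 1 0
  obtain ⟨g, hg⟩ := hp_dvd 1 s
  refine ⟨a - f t * b + c * d + e * g, ?_⟩
  dsimp only at ha
  linear_combination ha - f t * hb + (s - t) * (f 0 - f t) * hc + (s - t) * p * c * hd
    + (s - t) * (u 1 - u s) * he + (s - t) * p * e * hg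

end IsLinearModSq

/-- The natural numbers below `p ^ N` which are prime to `p`. -/
def coprimeRange (p N : ℕ) : Finset ℕ := {j ∈ range (p ^ N) | ¬p ∣ j}

lemma sum_coprimeRange_mul_mod {M : Type*} [AddCommMonoid M] {c N : ℕ} (hc : ¬p ∣ c) (hN : N ≠ 0)
    (g : ℕ → M) : ∑ j ∈ coprimeRange p N, g (c * j % p ^ N) = ∑ j ∈ coprimeRange p N, g j := by
  have hp : p.Prime := Fact.out
  have hmaps : Set.MapsTo (fun j => c * j % p ^ N) (coprimeRange p N) (coprimeRange p N) := by
    intro j hj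
    simp only [coprimeRange, coe_filter, mem_range, Set.mem_ofPred_eq] at hj ⊢
    refine ⟨Nat.mod_lt _ (pow_pos hp.pos _), ?_⟩
    rw [Nat.dvd_mod_iff (dvd_pow_self p hN), hp.dvd_mul]
    tauto
  have hinj : Set.InjOn (fun j => c * j % p ^ N) (coprimeRange p N) := by
    intro i hi j hj hij
    simp only [coprimeRange, coe_filter, mem_range, Set.mem_ofPred_eq] at hi hj
    have hcop : Nat.gcd (p ^ N) c = 1 := ((hp.coprime_iff_not_dvd).2 hc).pow_left N
    have h : i ≡ j [MOD p ^ N] := Nat.ModEq.cancel_left_of_coprime hcop hij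
    exact h.eq_of_lt_of_lt hi.1 hj.1
  exact sum_nbij _ hmaps hinj (surjOn_of_injOn_of_card_le _ hmaps hinj le_rfl) fun _ _ => rfl

lemma sum_coprimeRange_pow (n N : ℕ) :
    ∑ j ∈ coprimeRange p (N + 1), (j : ℚ) ^ n =
      ∑ j ∈ range (p ^ (N + 1)), (j : ℚ) ^ n - p ^ n * ∑ j ∈ range (p ^ N), (j : ℚ) ^ n := by
  have hp : p.Prime := Fact.out
  rw [coprimeRange, ← sum_filter_add_sum_filter_not (range (p ^ (N + 1))) (p ∣ ·), mul_sum,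
    eq_sub_iff_add_eq, add_comm]
  congr 1
  refine sum_nbij (p * ·) ?_ ?_ ?_ ?_
  · intro j hj
    simp only [mem_range, mem_filter, dvd_mul_right, and_true] at hj ⊢
    rw [pow_succ']
    exact Nat.mul_lt_mul_of_pos_left hj hp.pos
  · exact fun i _ j _ h => Nat.eq_of_mul_eq_mul_left hp.pos h
  · intro j hj
    simp only [coe_filter, mem_range, Set.mem_ofPred_eq] at hj
    obtain ⟨hj, i, rfl⟩ := hj
    rw [pow_succ'] at hj
    exact ⟨i, by simpa using Nat.lt_of_mul_lt_mul_left hj, rfl⟩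
  · intro j _
    push_cast
    ring

/-- Riemann sums for the `p`-adic measure regularising the values `(1 - p ^ (n - 1)) * B_n / n`. -/
noncomputable def voronoiSum (p : ℕ) [Fact p.Prime] (c N n : ℕ) : ℤ_[p] :=
  ∑ j ∈ coprimeRange p N, ((c * j / p ^ N : ℕ) : ℤ_[p]) * ((c * j : ℕ) : ℤ_[p]) ^ (n - 1)

lemma exists_voronoi_congruence {c N : ℕ} (hc : ¬p ∣ c) (hN : N ≠ 0) (n : ℕ) :
    ∃ z : ℤ_[p], ((c : ℤ_[p]) ^ n - 1) * ∑ j ∈ coprimeRange p N, (j : ℤ_[p]) ^ n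
      - n * p ^ N * voronoiSum p c N n = ((p : ℤ_[p]) ^ N) ^ 2 * z := by
  have key : ∀ j : ℕ, ∃ z : ℤ_[p], (c : ℤ_[p]) ^ n * (j : ℤ_[p]) ^ n
      - ((c * j % p ^ N : ℕ) : ℤ_[p]) ^ n
      - n * p ^ N * (((c * j / p ^ N : ℕ) : ℤ_[p]) * ((c * j : ℕ) : ℤ_[p]) ^ (n - 1))
      = ((p : ℤ_[p]) ^ N) ^ 2 * z := by
    intro j
    have hdiv : (p : ℤ_[p]) ^ N * ((c * j / p ^ N : ℕ) : ℤ_[p]) + ((c * j % p ^ N : ℕ) : ℤ_[p])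
        = ((c * j : ℕ) : ℤ_[p]) := by
      exact_mod_cast congrArg (Nat.cast (R := ℤ_[p])) (Nat.div_add_mod (c * j) (p ^ N))
    generalize ((c * j / p ^ N : ℕ) : ℤ_[p]) = q at *
    generalize ((c * j % p ^ N : ℕ) : ℤ_[p]) = r at *
    obtain ⟨k, hk⟩ := Polynomial.powAddExpansion ((c * j : ℕ) : ℤ_[p]) (-(p ^ N * q)) n
    have hr : r = ((c * j : ℕ) : ℤ_[p]) + -(p ^ N * q) := by linear_combination hdiv
    refine ⟨-(k * q ^ 2), ?_⟩
    rw [hr, hk, Nat.cast_mul, mul_pow]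
    ring
  choose z hz using key
  refine ⟨∑ j ∈ coprimeRange p N, z j, ?_⟩
  rw [mul_sum (coprimeRange p N) z, ← sum_congr rfl fun j _ => hz j, sum_sub_distrib, sum_sub_distrib,
    sum_coprimeRange_mul_mod hc hN fun j => (j : ℤ_[p]) ^ n, ← mul_sum, ← mul_sum, voronoiSum]
  ring

lemma exists_norm_sum_range_pow_sub_le (n : ℕ) : ∃ C : ℝ, 0 ≤ C ∧ ∀ N : ℕ,
    ‖((∑ j ∈ range (p ^ N), (j : ℚ) ^ n - p ^ N * bernoulli n : ℚ) : ℚ_[p])‖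
      ≤ C * ((p : ℝ) ^ (-(N : ℤ))) ^ 2 := by
  refine ⟨∑ i ∈ range n, ‖((bernoulli i * (n + 1).choose i / (n + 1) : ℚ) : ℚ_[p])‖,
    sum_nonneg fun _ _ => norm_nonneg _, fun N => ?_⟩
  have hn : (n : ℚ) + 1 ≠ 0 := by positivity
  have h : ∑ j ∈ range (p ^ N), (j : ℚ) ^ n - p ^ N * bernoulli n
      = ∑ i ∈ range n, bernoulli i * (n + 1).choose i / (n + 1) * (p ^ N) ^ (n - 1 - i)
        * (p ^ N) ^ 2 := by
    rw [sum_range_pow, sum_range_succ]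
    have h1 : ∀ i ∈ range n, bernoulli i * ((n + 1).choose i : ℚ) * ((p ^ N : ℕ) : ℚ) ^ (n + 1 - i)
        / (n + 1) = bernoulli i * (n + 1).choose i / (n + 1) * (p ^ N) ^ (n - 1 - i)
        * (p ^ N) ^ 2 := by
      intro i hi
      rw [mem_range] at hi
      rw [show n + 1 - i = n - 1 - i + 2 by omega, pow_add]
      push_cast
      ring
    rw [sum_congr rfl h1, Nat.choose_succ_self_right, show n + 1 - n = 1 by omega, pow_one,
      add_sub_assoc, add_eq_left]
    push_cast
    field_simp
    simp
  have hpow : ‖((p : ℚ_[p]) ^ N)‖ = (p : ℝ) ^ (-(N : ℤ)) := by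
    exact_mod_cast Padic.norm_p_zpow (p := p) (N : ℤ)
  have hle : ‖((p : ℚ_[p]) ^ N)‖ ≤ 1 := by
    rw [norm_pow]; exact pow_le_one₀ (norm_nonneg _) Padic.norm_p_lt_one.le
  rw [h, Rat.cast_sum, sum_mul, ← hpow]
  refine (norm_sum_le _ _).trans (sum_le_sum fun i _ => ?_)
  rw [Rat.cast_mul, Rat.cast_mul, norm_mul, norm_mul]
  push_cast
  rw [norm_pow (_ ^ N), norm_pow (_ ^ N)]
  gcongr
  exact mul_le_of_le_one_right (norm_nonneg _) (pow_le_one₀ (norm_nonneg _) hle)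

lemma exists_norm_sum_coprimeRange_pow_sub_le {n : ℕ} (hn : 2 ≤ n) : ∃ C : ℝ, 0 ≤ C ∧ ∀ N : ℕ,
    ‖((∑ j ∈ coprimeRange p (N + 1), (j : ℚ) ^ n
        - p ^ (N + 1) * (1 - p ^ (n - 1)) * bernoulli n : ℚ) : ℚ_[p])‖
      ≤ C * ((p : ℝ) ^ (-((N + 1 : ℕ) : ℤ))) ^ 2 := by
  obtain ⟨C, hC, h⟩ := exists_norm_sum_range_pow_sub_le (p := p) n
  refine ⟨C, hC, fun N => ?_⟩
  have hp0 : (p : ℝ) ≠ 0 := by exact_mod_cast (Fact.out : p.Prime).ne_zero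
  have heq : ∑ j ∈ coprimeRange p (N + 1), (j : ℚ) ^ n
        - p ^ (N + 1) * (1 - p ^ (n - 1)) * bernoulli n
      = (∑ j ∈ range (p ^ (N + 1)), (j : ℚ) ^ n - p ^ (N + 1) * bernoulli n)
        - p ^ n * (∑ j ∈ range (p ^ N), (j : ℚ) ^ n - p ^ N * bernoulli n) := by
    obtain ⟨k, rfl⟩ := Nat.exists_eq_add_of_le' hn
    rw [sum_coprimeRange_pow, show k + 2 - 1 = k + 1 by omega]
    ring
  rw [heq, Rat.cast_sub, sub_eq_add_neg]
  refine (Padic.nonarchimedean _ _).trans (max_le (h (N + 1)) ?_)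
  rw [norm_neg, Rat.cast_mul, norm_mul]
  have hpn : ‖(((p : ℚ) ^ n : ℚ) : ℚ_[p])‖ ≤ ((p : ℝ) ^ (-1 : ℤ)) ^ 2 := by
    push_cast
    rw [norm_pow, Padic.norm_p, zpow_neg_one]
    refine pow_le_pow_of_le_one (by positivity) ?_ hn
    exact inv_le_one_of_one_le₀ (by exact_mod_cast (Fact.out : p.Prime).one_le)
  calc _ ≤ ((p : ℝ) ^ (-1 : ℤ)) ^ 2 * (C * ((p : ℝ) ^ (-(N : ℤ))) ^ 2) :=
        mul_le_mul hpn (h N) (norm_nonneg _) (by positivity)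
    _ = C * (((p : ℝ) ^ (-1 : ℤ)) * ((p : ℝ) ^ (-(N : ℤ)))) ^ 2 := by ring
    _ = _ := by
      rw [← zpow_add₀ hp0]
      push_cast
      rw [neg_add_rev]

/-- The number `B_n / n` with the Euler factor at `p` removed. -/
noncomputable def eulerBernoulli (p n : ℕ) : ℚ := (1 - (p : ℚ) ^ (n - 1)) * (bernoulli n / (n : ℚ))

lemma tendsto_voronoiSum {c n : ℕ} (hc : ¬p ∣ c) (hn : 2 ≤ n) :
    Tendsto (fun N => (voronoiSum p c (N + 1) n : ℚ_[p])) atTop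
      (𝓝 (((c : ℚ_[p]) ^ n - 1) * (eulerBernoulli p n : ℚ_[p]))) := by
  obtain ⟨C, hC, h⟩ := exists_norm_sum_coprimeRange_pow_sub_le (p := p) hn
  have hp1 : 1 < p := (Fact.out : p.Prime).one_lt
  have hp0 : (0 : ℝ) < p := by exact_mod_cast hp1.le
  have hn0 : (n : ℚ_[p]) ≠ 0 := by exact_mod_cast (show n ≠ 0 by omega)
  have hnn : 0 < ‖(n : ℚ_[p])‖ := norm_pos_iff.2 hn0
  rw [tendsto_iff_norm_sub_tendsto_zero]
  have hlim : Tendsto (fun N : ℕ => (1 + C) / ‖(n : ℚ_[p])‖ * ((p : ℝ)⁻¹) ^ (N + 1)) atTop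
      (𝓝 0) := by
    rw [← mul_zero ((1 + C) / ‖(n : ℚ_[p])‖)]
    refine ((tendsto_pow_atTop_nhds_zero_of_lt_one (by positivity) ?_).comp
      (tendsto_add_atTop_nat 1)).const_mul _
    exact inv_lt_one_of_one_lt₀ (by exact_mod_cast hp1)
  refine squeeze_zero (fun _ => norm_nonneg _) (fun N => ?_) hlim
  obtain ⟨z, hz⟩ := exists_voronoi_congruence (p := p) hc (show N + 1 ≠ 0 by omega) n
  replace hz := congrArg (fun x : ℤ_[p] => (x : ℚ_[p])) hz
  replace h := h N
  have hB : (bernoulli n : ℚ_[p]) = n * ((bernoulli n / n : ℚ) : ℚ_[p]) := by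
    push_cast
    field_simp
  set P : ℝ := (p : ℝ) ^ (-((N + 1 : ℕ) : ℤ)) with hP
  have hPpos : 0 < P := by positivity
  have hpow : ‖((p : ℚ_[p]) ^ (N + 1))‖ = P := by
    rw [hP, ← Padic.norm_p_zpow (p := p), zpow_natCast]
  have heq : (n : ℚ_[p]) * p ^ (N + 1) * ((voronoiSum p c (N + 1) n : ℚ_[p])
        - ((c : ℚ_[p]) ^ n - 1) * (eulerBernoulli p n : ℚ_[p]))
      = ((c : ℚ_[p]) ^ n - 1) * ((∑ j ∈ coprimeRange p (N + 1), (j : ℚ) ^ n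
        - p ^ (N + 1) * (1 - p ^ (n - 1)) * bernoulli n : ℚ) : ℚ_[p])
        + -((p ^ (N + 1)) ^ 2 * z) := by
    push_cast [PadicInt.coe_sum] at hz
    rw [eulerBernoulli, Rat.cast_sub, Rat.cast_mul _ (bernoulli n), hB]
    push_cast
    linear_combination -hz
  have hc1 : ‖(c : ℚ_[p]) ^ n - 1‖ ≤ 1 := by
    have := PadicInt.norm_le_one ((c : ℤ_[p]) ^ n - 1)
    rw [PadicInt.norm_def] at this
    exact_mod_cast this
  have hbound : ‖(n : ℚ_[p])‖ * P * ‖(voronoiSum p c (N + 1) n : ℚ_[p])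
      - ((c : ℚ_[p]) ^ n - 1) * (eulerBernoulli p n : ℚ_[p])‖ ≤ (1 + C) * P ^ 2 := by
    rw [← hpow, ← norm_mul, ← norm_mul, heq, hpow]
    refine (norm_add_le _ _).trans ?_
    rw [norm_neg, norm_mul, norm_mul, norm_pow, hpow, ← PadicInt.norm_def]
    have h1 := mul_le_mul hc1 h (norm_nonneg _) zero_le_one
    have h2 := mul_le_mul_of_nonneg_left (PadicInt.norm_le_one z) (sq_nonneg P)
    linarith
  have hPp : ((p : ℝ)⁻¹) ^ (N + 1) = P := by
    rw [hP, zpow_neg, inv_pow, zpow_natCast]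
  rw [hPp, div_mul_eq_mul_div, le_div_iff₀ hnn]
  refine le_of_mul_le_mul_right ?_ hPpos
  linarith

lemma exists_isUnit_pow_sub_one {l : ℕ} (hl0 : 0 < l) (hlp : l < p - 1) :
    ∃ c : ℕ, ¬p ∣ c ∧ IsUnit ((c : ℤ_[p]) ^ l - 1) := by
  obtain ⟨g, hg⟩ := IsCyclic.exists_ofOrder_eq_natCard (α := (ZMod p)ˣ)
  rw [Nat.card_eq_fintype_card, ZMod.card_units] at hg
  refine ⟨(g : ZMod p).val, fun h => ?_, ?_⟩
  · rw [← ZMod.natCast_eq_zero_iff, ZMod.natCast_zmod_val] at h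
    exact g.ne_zero h
  · by_contra h
    rw [PadicInt.not_isUnit_iff, PadicInt.norm_lt_one_iff_dvd] at h
    have h' := map_dvd (PadicInt.toZMod (p := p)) h
    simp only [map_natCast, CharP.cast_eq_zero, map_sub, map_pow, ZMod.natCast_zmod_val, map_one,
      zero_dvd_iff, sub_eq_zero] at h'
    exact pow_ne_one_of_lt_orderOf hl0.ne' (hg ▸ hlp) (Units.ext (by simpa using h'))

lemma p_dvd_natCast_pow_sub_one {a : ℕ} (ha : ¬p ∣ a) :
    (p : ℤ_[p]) ∣ ((a : ℤ_[p]) ^ (p - 1)) - 1 := by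
  have hp : p.Prime := Fact.out
  have h := (Int.ModEq.pow_card_sub_one_eq_one hp
    (Nat.isCoprime_iff_coprime.2 ((hp.coprime_iff_not_dvd.2 ha).symm))).symm.dvd
  have := map_dvd (Int.castRingHom ℤ_[p]) h
  simpa using this

lemma isLinearModSq_natCast_pow (hp : 3 ≤ p) {a : ℕ} (ha : ¬p ∣ a) (k : ℕ) :
    IsLinearModSq fun s => (a : ℤ_[p]) ^ (k + (p - 1) * s) := by
  simpa only [pow_add, pow_mul] using
    (IsLinearModSq.pow hp (p_dvd_natCast_pow_sub_one ha)).const_mul ((a : ℤ_[p]) ^ k)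

lemma isLinearModSq_voronoiSum (hp : 3 ≤ p) {c l : ℕ} (hc : ¬p ∣ c) (hl : 1 ≤ l) (N : ℕ) :
    IsLinearModSq fun s => voronoiSum p c N (l + (p - 1) * s) := by
  refine IsLinearModSq.sum _ fun j hj => ?_
  have hcj : ¬p ∣ c * j := by
    rw [(Fact.out : p.Prime).dvd_mul]
    have := (mem_filter.1 hj).2
    tauto
  have := (isLinearModSq_natCast_pow hp hcj (l - 1)).const_mul ((c * j / p ^ N : ℕ) : ℤ_[p])
  convert this using 5
  omega

/-- **Kummer congruences**, refined: the numbers `(1 - p ^ (n - 1)) * B_n / n` for `n` in a fixed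
nonzero residue class modulo `p - 1` are `p`-integral and agree with a linear function up to a
relative error of `p ^ 2`. -/
lemma exists_isLinearModSq_eulerBernoulli (hp : 3 ≤ p) {l : ℕ} (hl2 : 2 ≤ l) (hlp : l < p - 1) :
    ∃ f : ℕ → ℤ_[p], IsLinearModSq f ∧
      ∀ s, (f s : ℚ_[p]) = (eulerBernoulli p (l + (p - 1) * s) : ℚ_[p]) := by
  obtain ⟨c, hc, hcl⟩ := exists_isUnit_pow_sub_one (p := p) (by omega) hlp
  set u : ℕ → ℤ_[p] := fun s => (c : ℤ_[p]) ^ (l + (p - 1) * s) - 1 with hu_def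
  have hu : IsLinearModSq u := (isLinearModSq_natCast_pow hp hc l).sub_const 1
  have hu0 : IsUnit (u 0) := by simpa [hu_def] using hcl
  have hlim : ∀ s, Tendsto (fun N => (voronoiSum p c (N + 1) (l + (p - 1) * s) : ℚ_[p])) atTop
      (𝓝 ((u s : ℚ_[p]) * (eulerBernoulli p (l + (p - 1) * s) : ℚ_[p]))) := by
    intro s
    have := tendsto_voronoiSum (p := p) hc (hl2.trans (Nat.le_add_right l ((p - 1) * s)))
    simpa [hu_def] using this
  have hintegral : ∀ s, ‖(eulerBernoulli p (l + (p - 1) * s) : ℚ_[p])‖ ≤ 1 := by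
    intro s
    have h := le_of_tendsto (hlim s).norm (.of_forall fun N => PadicInt.norm_le_one _)
    rwa [norm_mul, ← PadicInt.norm_def, PadicInt.isUnit_iff.1 (hu.isUnit hu0 s), one_mul] at h
  refine ⟨fun s => ⟨_, hintegral s⟩, hu.of_mul hu0 ?_, fun s => rfl⟩
  have hT := isLinearModSq_voronoiSum (l := l) hp hc (by omega)
  refine .of_tendsto (fun N => hT (N + 1)) fun s => ?_
  rw [tendsto_iff_norm_sub_tendsto_zero]
  exact (tendsto_iff_norm_sub_tendsto_zero (E := ℚ_[p])).1 (hlim s)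

lemma IsLinearModSq.p_pow_succ_dvd_iff {f : ℕ → ℤ_[p]} (hf : IsLinearModSq f)
    (h : ¬(p : ℤ_[p]) ^ 2 ∣ f 1 - f 0) (s t r : ℕ) :
    (p : ℤ_[p]) ^ (r + 1) ∣ f s - f t ↔ (p : ℤ) ^ r ∣ (s : ℤ) - t := by
  obtain ⟨a, ha⟩ := hf.1
  obtain ⟨w, hw⟩ := hf.2 s t
  have hunit : IsUnit (a + p * w) := by
    by_contra hu
    rw [PadicInt.not_isUnit_iff, PadicInt.norm_lt_one_iff_dvd, dvd_add_left (dvd_mul_right _ _)]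
      at hu
    obtain ⟨b, rfl⟩ := hu
    exact h ⟨b, by rw [ha]; ring⟩
  have heq : f s - f t = p * ((((s : ℤ) - t : ℤ) : ℤ_[p]) * (a + p * w)) := by
    push_cast
    rw [ha] at hw
    linear_combination hw
  rw [heq, pow_succ', mul_dvd_mul_iff_left PadicInt.prime_p.ne_zero, hunit.dvd_mul_right,
    PadicInt.pow_p_dvd_int_iff]

lemma padicNorm_le_iff_p_pow_dvd {x : ℤ_[p]} {q : ℚ} (hx : (x : ℚ_[p]) = q) (r : ℕ) :
    padicNorm p q ≤ (p : ℚ) ^ (-(r : ℤ)) ↔ (p : ℤ_[p]) ^ r ∣ x := by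
  rw [← Ideal.mem_span_singleton, ← PadicInt.norm_le_pow_iff_mem_span_pow, PadicInt.norm_def, hx,
    Padic.eq_padicNorm, ← Rat.cast_le (K := ℝ), Rat.cast_zpow, Rat.cast_natCast]

lemma inv_p_le_padicNorm_iff {x : ℤ_[p]} {q : ℚ} (hx : (x : ℚ_[p]) = q) :
    (p : ℚ) ^ (-1 : ℤ) ≤ padicNorm p q ↔ ¬(p : ℤ_[p]) ^ 2 ∣ x := by
  rw [← Ideal.mem_span_singleton, ← PadicInt.norm_le_pow_iff_mem_span_pow,
    PadicInt.norm_le_pow_iff_norm_lt_pow_add_one, not_lt, PadicInt.norm_def, hx,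
    Padic.eq_padicNorm, ← Rat.cast_le (K := ℝ), Rat.cast_zpow, Rat.cast_natCast]
  rfl

lemma exists_coe_eq_bernoulli_div {n : ℕ} (hn : 2 ≤ n) {x : ℤ_[p]}
    (hx : (x : ℚ_[p]) = eulerBernoulli p n) :
    ∃ b : ℤ_[p], (b : ℚ_[p]) = ((bernoulli n / n : ℚ) : ℚ_[p]) ∧ x = (1 - p ^ (n - 1)) * b := by
  have hu : IsUnit (1 - (p : ℤ_[p]) ^ (n - 1)) := by
    by_contra h
    rw [PadicInt.not_isUnit_iff, PadicInt.norm_lt_one_iff_dvd,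
      dvd_sub_left (dvd_pow_self _ (by omega))] at h
    exact PadicInt.prime_p.not_isUnit (isUnit_of_dvd_one h)
  obtain ⟨b, rfl⟩ := hu.dvd (a := x)
  refine ⟨b, ?_, rfl⟩
  have h0 : ((1 - (p : ℤ_[p]) ^ (n - 1) : ℤ_[p]) : ℚ_[p]) ≠ 0 := by
    simpa only [ne_eq, PadicInt.coe_eq_zero] using hu.ne_zero
  refine mul_left_cancel₀ h0 ?_
  rw [← PadicInt.coe_mul, hx, eulerBernoulli]
  push_cast
  rfl

lemma exists_eq_add_mul_of_dvd_sub {l n : ℕ} (hlp : l < p - 1)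
    (h : ((p : ℤ) - 1) ∣ (n : ℤ) - l) : ∃ s : ℕ, n = l + (p - 1) * s := by
  have hp : ((p - 1 : ℕ) : ℤ) = (p : ℤ) - 1 := by
    have := (Fact.out : p.Prime).one_lt
    omega
  rw [← hp] at h
  have hmod : n % (p - 1) = l := by
    rw [← Nat.mod_eq_of_lt hlp]
    exact ((Nat.modEq_iff_dvd).2 h).symm
  exact ⟨n / (p - 1), by rw [← hmod, Nat.mod_add_div]⟩

end PadicCongruences

theorem stmt19 (p : ℕ) (hp : p.Prime) (hp3 : 3 < p) (l : ℕ) (hl : Even l) (hl0 : 0 < l)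
    (hlp : l < p - 1) (ε : ℚ) (hε : ε = if l = 2 then 1 - (p : ℚ) else 1) :
    (p : ℚ) ^ (-1 : ℤ) ≤
        padicNorm p (bernoulli (l + p - 1) / ((l + p - 1 : ℕ) : ℚ) - ε * (bernoulli l / (l : ℚ))) ↔
      ∀ (n m : ℕ) (r : ℕ), Even n → Even m → 0 < n → 0 < m →
        ((p : ℤ) - 1) ∣ ((n : ℤ) - (l : ℤ)) → ((p : ℤ) - 1) ∣ ((m : ℤ) - (l : ℤ)) → 1 ≤ r →
          ((p : ℤ) ^ (r - 1) * ((p : ℤ) - 1) ∣ ((n : ℤ) - (m : ℤ)) ↔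
            padicNorm p ((1 - (p : ℚ) ^ (n - 1)) * (bernoulli n / (n : ℚ)) -
                (1 - (p : ℚ) ^ (m - 1)) * (bernoulli m / (m : ℚ))) ≤ (p : ℚ) ^ (-(r : ℤ))) := by
  have : Fact p.Prime := ⟨hp⟩
  have hl2 : 2 ≤ l := by
    obtain ⟨k, rfl⟩ := hl
    omega
  obtain ⟨f, hf, hfE⟩ := exists_isLinearModSq_eulerBernoulli (p := p) (by omega) hl2 hlp
  have hsub : ∀ s t, ((f s - f t : ℤ_[p]) : ℚ_[p]) =
      ((eulerBernoulli p (l + (p - 1) * s) - eulerBernoulli p (l + (p - 1) * t) : ℚ) : ℚ_[p]) := by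
    intro s t
    rw [PadicInt.coe_sub, hfE, hfE, Rat.cast_sub]
  have hfirst : (p : ℚ) ^ (-1 : ℤ) ≤ padicNorm p (bernoulli (l + p - 1) / ((l + p - 1 : ℕ) : ℚ)
      - ε * (bernoulli l / (l : ℚ))) ↔ ¬(p : ℤ_[p]) ^ 2 ∣ f 1 - f 0 := by
    have hl1 : l + (p - 1) * 1 = l + p - 1 := by omega
    have hf0 := hfE 0
    have hf1 := hfE 1
    rw [mul_zero, add_zero] at hf0
    rw [hl1] at hf1
    obtain ⟨b₀, hb₀, hfb₀⟩ := exists_coe_eq_bernoulli_div hl2 hf0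
    obtain ⟨b₁, hb₁, hfb₁⟩ := exists_coe_eq_bernoulli_div (by omega) hf1
    have hp1 : (p : ℤ_[p]) ^ 2 ∣ p ^ (l + p - 1 - 1) * b₁ :=
      (pow_dvd_pow _ (by omega)).mul_right _
    by_cases h2 : l = 2
    · have hx : ((b₁ - (1 - p) * b₀ : ℤ_[p]) : ℚ_[p]) = ((bernoulli (l + p - 1)
          / ((l + p - 1 : ℕ) : ℚ) - ε * (bernoulli l / (l : ℚ)) : ℚ) : ℚ_[p]) := by
        rw [hε, if_pos h2, Rat.cast_sub, ← hb₁, Rat.cast_mul, ← hb₀]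
        push_cast
        rfl
      rw [inv_p_le_padicNorm_iff hx, not_iff_not, ← dvd_sub_left hp1, hfb₀, hfb₁]
      subst h2
      ring_nf
    · have hx : ((b₁ - b₀ : ℤ_[p]) : ℚ_[p]) = ((bernoulli (l + p - 1)
          / ((l + p - 1 : ℕ) : ℚ) - ε * (bernoulli l / (l : ℚ)) : ℚ) : ℚ_[p]) := by
        rw [hε, if_neg h2, one_mul, Rat.cast_sub, ← hb₁, ← hb₀, PadicInt.coe_sub]
      have hp0 : (p : ℤ_[p]) ^ 2 ∣ p ^ (l - 1) * b₀ := (pow_dvd_pow _ (by omega)).mul_right _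
      rw [inv_p_le_padicNorm_iff hx, not_iff_not, ← dvd_sub_left (dvd_sub hp1 hp0), hfb₀, hfb₁]
      ring_nf
  rw [hfirst]
  have hp1 : ((p : ℤ) - 1) ≠ 0 := by omega
  have hcast : ((p - 1 : ℕ) : ℤ) = (p : ℤ) - 1 := by omega
  constructor
  · intro h n m r _ _ _ _ hnl hml hr
    obtain ⟨s, rfl⟩ := exists_eq_add_mul_of_dvd_sub hlp hnl
    obtain ⟨t, rfl⟩ := exists_eq_add_mul_of_dvd_sub hlp hml
    obtain ⟨r, rfl⟩ := Nat.exists_eq_add_of_le' hr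
    rw [← eulerBernoulli, ← eulerBernoulli, padicNorm_le_iff_p_pow_dvd (hsub s t),
      hf.p_pow_succ_dvd_iff h, Nat.add_sub_cancel, mul_comm]
    rw [show ((l + (p - 1) * s : ℕ) : ℤ) - ((l + (p - 1) * t : ℕ) : ℤ)
      = ((p : ℤ) - 1) * ((s : ℤ) - t) by push_cast [hcast]; ring]
    exact mul_dvd_mul_iff_left hp1
  · intro h hdvd
    have hpe : Even (p - 1) := hp.even_sub_one (by omega)
    have := (h (l + (p - 1) * 1) (l + (p - 1) * 0) 2 (hl.add (hpe.mul_right _)) (by simpa using hl)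
      (by omega) (by omega) (by push_cast [hcast]; simp) (by simp) (by omega)).2
    rw [← eulerBernoulli, ← eulerBernoulli, padicNorm_le_iff_p_pow_dvd (hsub 1 0)] at this
    have h1 := this hdvd
    rw [show ((l + (p - 1) * 1 : ℕ) : ℤ) - ((l + (p - 1) * 0 : ℕ) : ℤ)
      = 1 * ((p : ℤ) - 1) by push_cast [hcast]; ring, mul_dvd_mul_iff_right hp1] at h1
    have h3 := Int.le_of_dvd one_pos h1
    simp at h3
    omega
end
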